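/- arXiv:2005.03964 — 3 statements merged into one kernel-verified Lean document; each statement's English description precedes it below -/
import Mathlib

section
/- Let A be a reduced Noetherian commutative ring, Q(A) its total ring of fractions, and Ā the normalization of A (the integral closure of A in Q(A)). Let P₁,…,P_s (s ≥ 1) be prime ideals of A such that for every prime ideal P of A not among P₁,…,P_s and every z ∈ Ā, there exists t ∈ A \ P with t·z ∈ A (i.e., the localization of A at P is integrally closed). Suppose for each 1 ≤ i ≤ s we are given an A-subalgebra A⁽ⁱ⁾ of Q(A) with A ⊆ A⁽ⁱ⁾ ⊆ Ā such that for every z ∈ Ā there exists t ∈ A \ P_i with t·z ∈ A⁽ⁱ⁾ (i.e., the localization of A⁽ⁱ⁾ at P_i is the normalization of the localization of A at P_i). Then Σᵢ A⁽ⁱ⁾ = Ā, that is, every element of Ā is a finite sum z₁ + ⋯ + z_s with zᵢ ∈ A⁽ⁱ⁾. -/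
set_option synthInstance.maxHeartbeats 1000000
set_option maxHeartbeats 1000000

/-- Let `A` be a reduced Noetherian commutative ring, `Q(A)` its total ring of
fractions and `Ā` the integral closure of `A` in `Q(A)`. Let `P₁, …, P_s` (`s ≥ 1`)
be prime ideals of `A` such that `A` is integrally closed locally at every other
prime, and for each `i` let `A⁽ⁱ⁾` be an `A`-subalgebra of `Q(A)` with
`A ⊆ A⁽ⁱ⁾ ⊆ Ā` whose localization at `P_i` is the normalization of the
localization of `A` at `P_i`. Then `Σᵢ A⁽ⁱ⁾ = Ā`. -/
theorem sum_of_local_contributions (A : Type*) [CommRing A] [IsReduced A]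
    [IsNoetherianRing A]
    (s : ℕ) (hs : 1 ≤ s) (P : Fin s → Ideal A) (hP : ∀ i, (P i).IsPrime)
    (hloc : ∀ Q : Ideal A, Q.IsPrime → Q ∉ Set.range P →
      ∀ z ∈ integralClosure A (FractionRing A), ∃ t : A, t ∉ Q ∧
        algebraMap A (FractionRing A) t * z ∈ Set.range (algebraMap A (FractionRing A)))
    (Asub : Fin s → Subalgebra A (FractionRing A))
    (hsub : ∀ i, Asub i ≤ integralClosure A (FractionRing A))
    (hloci : ∀ i, ∀ z ∈ integralClosure A (FractionRing A), ∃ t : A, t ∉ P i ∧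
      algebraMap A (FractionRing A) t * z ∈ Asub i) :
    ∀ z ∈ integralClosure A (FractionRing A), ∃ zs : Fin s → FractionRing A,
      (∀ i, zs i ∈ Asub i) ∧ z = ∑ i, zs i := by
  intro z hz
  let N : Submodule A (FractionRing A) := ⨆ i, Subalgebra.toSubmodule (Asub i)
  have hN (i : Fin s) {x : FractionRing A} (hx : x ∈ Asub i) : x ∈ N :=
    Submodule.mem_iSup_of_mem (p := fun i => Subalgebra.toSubmodule (Asub i)) i hx
  -- The ideal of all `a` with `a • z ∈ N` lies in no maximal ideal.
  let I : Ideal A := N.comap (LinearMap.toSpanSingleton A (FractionRing A) z)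
  have hI (t : A) (ht : algebraMap A (FractionRing A) t * z ∈ N) : t ∈ I := by
    simpa [I, Algebra.smul_def] using ht
  have hI_top : I = ⊤ := by
    by_contra h
    obtain ⟨M, hM, hIM⟩ := Ideal.exists_le_maximal I h
    by_cases hMP : M ∈ Set.range P
    · obtain ⟨i, rfl⟩ := hMP
      obtain ⟨t, ht, htz⟩ := hloci i z hz
      exact ht (hIM (hI t (hN i htz)))
    · obtain ⟨t, ht, a, ha⟩ := hloc M hM.isPrime hMP z hz
      exact ht (hIM (hI t (ha ▸ hN ⟨0, hs⟩ ((Asub ⟨0, hs⟩).algebraMap_mem a))))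
  have hzN : z ∈ N := by
    have h : (1 : A) ∈ I := hI_top ▸ Submodule.mem_top
    simpa [I] using h
  obtain ⟨f, hf, rfl⟩ := (Submodule.mem_iSup_iff_exists_finsupp _ z).1 hzN
  exact ⟨f, hf, f.sum_fintype _ fun _ => rfl⟩
end

section
/- Let K be a field of characteristic zero or greater than n, f ∈ K[x][y] monic in y, squarefree, of y-degree n, and φ ∈ K[x] irreducible. For i = 0, …, d−1 let pᵢ ∈ K[x][y] be monic in y of y-degree i and eᵢ ∈ ℕ be such that bᵢ = pᵢ/φ^{eᵢ} is integral over K[x] in A_f and eᵢ is maximal for degree i at φ. Then for any element z ∈ A_f there is at most one tuple (a₀,…,a_{d−1}) ∈ K^d such that (z + a₀b₀ + ⋯ + a_{d−1}b_{d−1})/φ is integral over K[x]. -/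
open Polynomial

set_option synthInstance.maxHeartbeats 1000000
set_option maxHeartbeats 1000000

/-- The algebra `A_f = K(x)[y]/⟨f⟩` associated to `f ∈ K[x][y]`. -/
noncomputable abbrev Af (K : Type*) [Field K] (f : Polynomial (Polynomial K)) : Type _ :=
  Polynomial (RatFunc K) ⧸ Ideal.span {f.map (algebraMap (Polynomial K) (RatFunc K))}

/-- The class of `p ∈ K[x][y]` in `A_f`. -/
noncomputable def toAf {K : Type*} [Field K] (f p : Polynomial (Polynomial K)) : Af K f :=
  Ideal.Quotient.mk _ (p.map (algebraMap (Polynomial K) (RatFunc K)))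

/-- `e` is a maximal exponent for degree `d` at the irreducible `φ`: some monic
`p ∈ K[x][y]` of `y`-degree `d` makes `p/φ^e` integral over `K[x]` in `A_f`, while
no monic `q` of `y`-degree `d` makes `q/φ^{e+1}` integral. -/
def MaximalExponent {K : Type*} [Field K] (f : Polynomial (Polynomial K))
    (φ : Polynomial K) (d e : ℕ) : Prop :=
  (∃ p : Polynomial (Polynomial K), p.Monic ∧ p.natDegree = d ∧
    ∃ z : Af K f, IsIntegral (Polynomial K) z ∧
      algebraMap (Polynomial K) (Af K f) (φ ^ e) * z = toAf f p) ∧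
  ¬ ∃ q : Polynomial (Polynomial K), q.Monic ∧ q.natDegree = d ∧
    ∃ z : Af K f, IsIntegral (Polynomial K) z ∧
      algebraMap (Polynomial K) (Af K f) (φ ^ (e + 1)) * z = toAf f q

/-- The ring homomorphism `K[x][y] → A_f` underlying `toAf`. -/
noncomputable def toAfHom {K : Type*} [Field K] (f : Polynomial (Polynomial K)) :
    Polynomial (Polynomial K) →+* Af K f :=
  (Ideal.Quotient.mk _).comp (mapRingHom (algebraMap (Polynomial K) (RatFunc K)))

theorem toAf_eq_toAfHom {K : Type*} [Field K] (f p : Polynomial (Polynomial K)) :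
    toAf f p = toAfHom f p := rfl

theorem algebraMap_Af_eq_toAfHom {K : Type*} [Field K] (f : Polynomial (Polynomial K))
    (g : Polynomial K) : algebraMap (Polynomial K) (Af K f) g = toAfHom f (C g) := by
  simp [toAfHom]
  rfl

theorem toAfHom_self {K : Type*} [Field K] (f : Polynomial (Polynomial K)) :
    toAfHom f f = 0 :=
  Ideal.Quotient.eq_zero_iff_mem.2 (Ideal.subset_span rfl)

theorem isIntegral_toAfHom_X {K : Type*} [Field K] {f : Polynomial (Polynomial K)}
    (hf : f.Monic) : IsIntegral (Polynomial K) (toAfHom f X) := by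
  refine ⟨f, hf, ?_⟩
  have h : algebraMap (Polynomial K) (Af K f) = (toAfHom f).comp C :=
    RingHom.ext (algebraMap_Af_eq_toAfHom f)
  rw [h, ← hom_eval₂, eval₂_C_X, toAfHom_self]

/-- A maximal exponent bounds every exponent realised by a monic polynomial of the same degree. -/
theorem MaximalExponent.le {K : Type*} [Field K] {f : Polynomial (Polynomial K)}
    {φ : Polynomial K} {d e : ℕ} (h : MaximalExponent f φ d e)
    {q : Polynomial (Polynomial K)} (hq : q.Monic) (hqd : q.natDegree = d) {m : ℕ}
    {w : Af K f} (hw : IsIntegral (Polynomial K) w)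
    (hwq : algebraMap (Polynomial K) (Af K f) (φ ^ m) * w = toAf f q) : m ≤ e := by
  by_contra! hlt
  refine h.2 ⟨q, hq, hqd, algebraMap (Polynomial K) (Af K f) (φ ^ (m - (e + 1))) * w,
    isIntegral_algebraMap.mul hw, ?_⟩
  rw [← mul_assoc, ← map_mul, ← pow_add, Nat.add_sub_cancel' hlt, hwq]

/-- Maximal exponents are monotone in the degree. -/
theorem MaximalExponent.mono {K : Type*} [Field K] {f : Polynomial (Polynomial K)}
    (hf : f.Monic) {φ : Polynomial K} {i k e e' : ℕ} (hik : i ≤ k)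
    (h : MaximalExponent f φ i e) (h' : MaximalExponent f φ k e') : e ≤ e' := by
  obtain ⟨⟨p, hp, hpd, w, hw, hwp⟩, -⟩ := h
  refine h'.le (q := X ^ (k - i) * p) ((monic_X_pow _).mul hp) ?_
    (((isIntegral_toAfHom_X hf).pow (k - i)).mul hw) ?_
  · rw [(monic_X_pow _).natDegree_mul hp, natDegree_X_pow, hpd, Nat.sub_add_cancel hik]
  · rw [mul_left_comm, hwp, toAf_eq_toAfHom, toAf_eq_toAfHom, map_mul, map_pow]

/-- Given `b₀, …, b_{d−1}` with `bᵢ = pᵢ/φ^{eᵢ}` integral and `eᵢ` maximal for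
degree `i` at `φ`, for any `z ∈ A_f` there is at most one tuple
`(a₀, …, a_{d−1}) ∈ K^d` such that `(z + a₀b₀ + ⋯ + a_{d−1}b_{d−1})/φ` is
integral over `K[x]`. -/
theorem unique_lin_combination (K : Type*) [Field K] (n : ℕ)
    (hchar : ∀ p : ℕ, CharP K p → p = 0 ∨ n < p)
    (f : Polynomial (Polynomial K)) (hf : f.Monic) (hsf : Squarefree f)
    (hdeg : f.natDegree = n)
    (φ : Polynomial K) (hφ : Irreducible φ)
    (d : ℕ) (p : Fin d → Polynomial (Polynomial K)) (e : Fin d → ℕ)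
    (b : Fin d → Af K f)
    (hpmonic : ∀ i, (p i).Monic) (hpdeg : ∀ i, (p i).natDegree = (i : ℕ))
    (hbint : ∀ i, IsIntegral (Polynomial K) (b i))
    (hbval : ∀ i, algebraMap (Polynomial K) (Af K f) (φ ^ e i) * b i = toAf f (p i))
    (hmax : ∀ i : Fin d, MaximalExponent f φ (i : ℕ) (e i))
    (z : Af K f) (a a' : Fin d → K)
    (ha : ∃ u : Af K f, IsIntegral (Polynomial K) u ∧
      algebraMap (Polynomial K) (Af K f) φ * u =
        z + ∑ i, algebraMap (Polynomial K) (Af K f) (Polynomial.C (a i)) * b i)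
    (ha' : ∃ u : Af K f, IsIntegral (Polynomial K) u ∧
      algebraMap (Polynomial K) (Af K f) φ * u =
        z + ∑ i, algebraMap (Polynomial K) (Af K f) (Polynomial.C (a' i)) * b i) :
    a = a' := by
  obtain ⟨u, hu, hua⟩ := ha
  obtain ⟨u', hu', hua'⟩ := ha'
  by_contra hne
  set c : Fin d → K := a - a' with hc
  have hw : algebraMap (Polynomial K) (Af K f) φ * (u - u') =
      ∑ i, algebraMap (Polynomial K) (Af K f) (C (c i)) * b i := by
    rw [mul_sub, hua, hua', add_sub_add_left_eq_sub, ← Finset.sum_sub_distrib]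
    exact Finset.sum_congr rfl fun i _ => by
      rw [hc, Pi.sub_apply, C_sub, map_sub, sub_mul]
  obtain ⟨j, hj⟩ : ∃ j, c j ≠ 0 := by
    by_contra! h
    exact hne (funext fun i => sub_eq_zero.1 (h i))
  obtain ⟨k, hk, hkmax⟩ : ∃ k, c k ≠ 0 ∧ ∀ i, k < i → c i = 0 := by
    classical
    have hs : (Finset.univ.filter fun i => c i ≠ 0).Nonempty := ⟨j, by simpa using hj⟩
    refine ⟨Finset.max' _ hs, by simpa using Finset.max'_mem _ hs, fun i hi => ?_⟩
    by_contra h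
    exact hi.not_ge (Finset.le_max' _ i (by simpa using h))
  let t : Fin d → Polynomial (Polynomial K) := fun i =>
    C (C (c i / c k) * φ ^ (e k - e i)) * p i
  have htk : t k = p k := by simp [t, hk]
  have hlow : (∑ i ∈ Finset.univ.erase k, t i).degree < (p k).degree := by
    rw [degree_eq_natDegree (hpmonic k).ne_zero, hpdeg k]
    refine (degree_sum_le _ _).trans_lt ((Finset.sup_lt_iff (WithBot.bot_lt_coe _)).2 ?_)
    intro i hi
    rcases lt_or_gt_of_ne (Finset.ne_of_mem_erase hi) with hik | hik
    · have hti : (t i).natDegree ≤ i := (natDegree_C_mul_le _ _).trans (hpdeg i).le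
      exact degree_le_natDegree.trans_lt (by exact_mod_cast hti.trans_lt hik)
    · simp [t, hkmax i hik]
  have hsum : ∑ i, t i = p k + ∑ i ∈ Finset.univ.erase k, t i := by
    rw [← htk, Finset.add_sum_erase _ _ (Finset.mem_univ k)]
  refine absurd ((hmax k).le (q := ∑ i, t i) (m := e k + 1)
    (w := algebraMap (Polynomial K) (Af K f) (C (c k)⁻¹) * (u - u')) ?_ ?_
    (isIntegral_algebraMap.mul (hu.sub hu')) ?_) (Nat.not_succ_le_self _)
  · rw [hsum]
    exact (hpmonic k).add_of_left hlow
  · rw [hsum, natDegree_add_eq_left_of_degree_lt hlow, hpdeg k]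
  · calc algebraMap (Polynomial K) (Af K f) (φ ^ (e k + 1)) *
          (algebraMap (Polynomial K) (Af K f) (C (c k)⁻¹) * (u - u'))
        = algebraMap (Polynomial K) (Af K f) (φ ^ e k) *
          algebraMap (Polynomial K) (Af K f) (C (c k)⁻¹) *
            (algebraMap (Polynomial K) (Af K f) φ * (u - u')) := by
          rw [pow_succ, map_mul]; ring
      _ = toAf f (∑ i, t i) := by
          rw [hw, Finset.mul_sum, toAf_eq_toAfHom, map_sum]
          refine Finset.sum_congr rfl fun i _ => ?_
          rcases le_or_gt i k with hik | hik
          · have hle : e i ≤ e k := (hmax i).mono hf hik (hmax k)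
            simp only [t]
            rw [map_mul, ← algebraMap_Af_eq_toAfHom, ← toAf_eq_toAfHom, ← hbval i,
              div_eq_mul_inv, C_mul, ← Nat.sub_add_cancel hle, pow_add, Nat.add_sub_cancel]
            simp only [map_mul]
            ring
          · simp [t, hkmax i hik]
end

section
/- Let K be a field of characteristic zero or greater than n, f ∈ K[x][y] monic in y, squarefree, of y-degree n, and φ ∈ K[x] irreducible. For d = 0, …, n−1 let p_d ∈ K[x][y] be monic in y of y-degree d and e_d ∈ ℕ be such that b_d = p_d/φ^{e_d} is integral over K[x] in A_f and e_d is maximal for degree d at φ. Then b₀,…,b_{n−1} form a local integral basis at φ: for every z ∈ A_f integral over K[x] there exist c₀,…,c_{n−1} ∈ K[x] and s ∈ K[x] with φ not dividing s such that s·z = c₀b₀ + ⋯ + c_{n−1}b_{n−1}. -/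
open Polynomial

set_option synthInstance.maxHeartbeats 1000000
set_option maxHeartbeats 1000000

section

variable {K : Type*} [Field K] {f : Polynomial (Polynomial K)}

lemma toAf_add (p q : Polynomial (Polynomial K)) : toAf f (p + q) = toAf f p + toAf f q := by
  simp [toAf]

lemma toAf_mul (p q : Polynomial (Polynomial K)) : toAf f (p * q) = toAf f p * toAf f q := by
  simp [toAf]

lemma toAf_sum {ι : Type*} (s : Finset ι) (p : ι → Polynomial (Polynomial K)) :
    toAf f (∑ i ∈ s, p i) = ∑ i ∈ s, toAf f (p i) := by
  simp [toAf, Polynomial.map_sum]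

lemma toAf_C (r : Polynomial K) : toAf f (C r) = algebraMap (Polynomial K) (Af K f) r := by
  rw [toAf, Polynomial.map_C]
  rfl

lemma toAf_self : toAf f f = 0 :=
  Ideal.Quotient.eq_zero_iff_mem.mpr (Ideal.mem_span_singleton_self _)

/-- `toAf` as an algebra homomorphism is evaluation at the class of `y`. -/
lemma toAf_eq_aeval (p : Polynomial (Polynomial K)) : toAf f p = aeval (toAf f X) p := by
  induction p using Polynomial.induction_on' with
  | add p q hp hq => rw [toAf_add, hp, hq, map_add]
  | monomial k r =>
    rw [← C_mul_X_pow_eq_monomial, toAf_mul, toAf_C, map_mul, aeval_C, map_pow, aeval_X]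
    simp [toAf]

lemma isIntegral_toAf (hf : f.Monic) (p : Polynomial (Polynomial K)) :
    IsIntegral (Polynomial K) (toAf f p) := by
  have hX : IsIntegral (Polynomial K) (toAf f X) :=
    ⟨f, hf, by rw [← aeval_def, ← toAf_eq_aeval, toAf_self]⟩
  rw [toAf_eq_aeval]
  exact adjoin_le_integralClosure hX (aeval_mem_adjoin_singleton _ _)

lemma isUnit_algebraMap_Af {r : Polynomial K} (hr : r ≠ 0) :
    IsUnit (algebraMap (Polynomial K) (Af K f) r) := by
  have h : IsUnit (algebraMap (Polynomial K) (RatFunc K) r) :=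
    ((map_ne_zero_iff _ (IsFractionRing.injective (Polynomial K) (RatFunc K))).mpr hr).isUnit
  exact h.map (algebraMap (RatFunc K) (Af K f))

/-- Every element of `A_f` is, up to a nonzero denominator in `K[x]`, the class of a
polynomial of `y`-degree less than that of `f`. -/
lemma exists_mul_eq_toAf (hf : f.Monic) (z : Af K f) :
    ∃ (r : Polynomial K) (h : Polynomial (Polynomial K)), r ≠ 0 ∧ h.degree < f.degree ∧
      algebraMap (Polynomial K) (Af K f) r * z = toAf f h := by
  obtain ⟨g, rfl⟩ := Ideal.Quotient.mk_surjective z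
  obtain ⟨r, hr0, hr⟩ := IsLocalization.integerNormalization_spec
    (nonZeroDivisors (Polynomial K)) g
  set h := IsLocalization.integerNormalization (nonZeroDivisors (Polynomial K)) g
  refine ⟨r, h %ₘ f, nonZeroDivisors.ne_zero hr0, degree_modByMonic_lt _ hf, ?_⟩
  have h1 : toAf f h = toAf f (h %ₘ f) := by
    conv_lhs => rw [← modByMonic_add_div h f]
    rw [toAf_add, toAf_mul, toAf_self, zero_mul, add_zero]
  rw [← h1, toAf, hr, Algebra.smul_def, map_mul]
  rfl

end

/-- A family of monic polynomials, one of each degree below `n`, spans the polynomials of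
degree less than `n`. -/
lemma exists_sum_C_mul_of_degree_lt {R : Type*} [CommRing R] {n : ℕ} (p : Fin n → R[X])
    (hpmonic : ∀ d, (p d).Monic) (hpdeg : ∀ d, (p d).natDegree = (d : ℕ))
    (k : ℕ) (hk : k ≤ n) (h : R[X]) (hh : h.degree < k) :
    ∃ c : Fin n → R, h = ∑ d, C (c d) * p d := by
  nontriviality R
  induction k generalizing h with
  | zero =>
    refine ⟨0, ?_⟩
    have : h = 0 := by simpa using hh
    simp [this]
  | succ k ih =>
    let d₀ : Fin n := ⟨k, hk⟩
    have hdeg : (C (h.coeff k) * p d₀).degree < (k + 1 : ℕ) := by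
      refine lt_of_le_of_lt ((degree_mul_le _ _).trans (add_le_of_nonpos_left degree_C_le)) ?_
      rw [degree_eq_natDegree (hpmonic d₀).ne_zero, hpdeg]
      exact_mod_cast Nat.lt_succ_self k
    obtain ⟨c, hc⟩ := ih (by omega) (h - C (h.coeff k) * p d₀) (by
      rw [degree_lt_iff_coeff_zero] at hh hdeg ⊢
      intro m hm
      rcases hm.eq_or_lt with rfl | hm
      · have h1 : (p d₀).coeff k = 1 := by
          have := (hpmonic d₀).coeff_natDegree
          rwa [hpdeg] at this
        simp [h1]
      · rw [coeff_sub, hh m hm, hdeg m hm, sub_zero])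
    refine ⟨c + Pi.single d₀ (h.coeff k), ?_⟩
    rw [sub_eq_iff_eq_add] at hc
    conv_lhs => rw [hc]
    simp [add_mul, Finset.sum_add_distrib, Pi.single_apply, apply_ite C, ite_mul]

section

variable {K : Type*} [Field K] {f : Polynomial (Polynomial K)}

/-- Maximal exponents are monotone in the degree. -/
lemma MaximalExponent.le_of_integral (hf : f.Monic) {φ : Polynomial K} {k e i e' : ℕ}
    (hmax : MaximalExponent f φ k e) (hik : i ≤ k) {p : Polynomial (Polynomial K)}
    (hp : p.Monic) (hpdeg : p.natDegree = i) {b : Af K f} (hb : IsIntegral (Polynomial K) b)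
    (hval : algebraMap (Polynomial K) (Af K f) (φ ^ e') * b = toAf f p) : e' ≤ e := by
  by_contra! hlt
  obtain ⟨m, rfl⟩ := Nat.exists_eq_add_of_lt hlt
  refine hmax.2 ⟨X ^ (k - i) * p, (monic_X_pow _).mul hp, ?_,
    algebraMap _ _ (φ ^ m) * (toAf f (X ^ (k - i)) * b),
    isIntegral_algebraMap.mul ((isIntegral_toAf hf _).mul hb), ?_⟩
  · rw [(monic_X_pow _).natDegree_mul hp, natDegree_X_pow, hpdeg]
    omega
  · rw [toAf_mul, ← hval]
    simp only [map_pow]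
    ring

variable {n : ℕ} {φ : Polynomial K} {p : Fin n → Polynomial (Polynomial K)} {e : Fin n → ℕ}
  {b : Fin n → Af K f}

/-- If an integral element times `φ` is a `K[x]`-combination of the `b d`, then `φ` divides
all the coefficients. -/
lemma dvd_coeff_of_integral (hf : f.Monic) (hφ : Irreducible φ)
    (hpmonic : ∀ d, (p d).Monic) (hpdeg : ∀ d, (p d).natDegree = (d : ℕ))
    (hbint : ∀ d, IsIntegral (Polynomial K) (b d))
    (hbval : ∀ d, algebraMap (Polynomial K) (Af K f) (φ ^ e d) * b d = toAf f (p d))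
    (hmax : ∀ d : Fin n, MaximalExponent f φ (d : ℕ) (e d))
    {z : Af K f} (hz : IsIntegral (Polynomial K) z) {c : Fin n → Polynomial K}
    (hzc : algebraMap (Polynomial K) (Af K f) φ * z =
      ∑ d, algebraMap (Polynomial K) (Af K f) (c d) * b d) (d : Fin n) : φ ∣ c d := by
  classical
  by_contra hd
  obtain ⟨k, hk, hkmax⟩ := (Finset.univ.filter fun d => ¬ φ ∣ c d).exists_maximal
    ⟨d, by simpa using hd⟩
  replace hk : ¬ φ ∣ c k := by simpa using hk
  have hdvd : ∀ i, k < i → φ ∣ c i := fun i hi => by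
    by_contra h
    exact absurd (hkmax (by simpa using h) hi.le) (not_le.mpr hi)
  choose! q hq using hdvd
  obtain ⟨u, t, hut⟩ : IsCoprime (c k) φ := ((hφ.coprime_iff_not_dvd).mpr hk).symm
  have hsplit : ∀ g : Fin n → Af K f, ∑ i, g i =
      ∑ i ∈ Finset.Iio k, g i + (g k + ∑ i ∈ Finset.Ioi k, g i) := fun g => by
    rw [← Finset.sum_filter_add_sum_filter_not Finset.univ (· < k)]
    congr 1
    · congr 1
      ext; simp
    · rw [← Finset.sum_insert (by simp)]
      congr 1
      ext i
      simp [le_iff_eq_or_lt]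
  let a := algebraMap (Polynomial K) (Af K f)
  let z' : Af K f := a u * (z - ∑ i ∈ Finset.Ioi k, a (q i) * b i) + a t * b k
  have hz' : IsIntegral (Polynomial K) z' :=
    (isIntegral_algebraMap.mul (hz.sub (IsIntegral.sum _ fun i _ =>
      isIntegral_algebraMap.mul (hbint i)))).add (isIntegral_algebraMap.mul (hbint k))
  have hφz' : a φ * z' = b k + ∑ i ∈ Finset.Iio k, a (u * c i) * b i := by
    have h1 : ∑ i ∈ Finset.Ioi k, a (c i) * b i = a φ * ∑ i ∈ Finset.Ioi k, a (q i) * b i := by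
      rw [Finset.mul_sum]
      refine Finset.sum_congr rfl fun i hi => ?_
      rw [hq i (Finset.mem_Ioi.mp hi), map_mul, mul_assoc]
    have h2 : ∑ i ∈ Finset.Iio k, a (u * c i) * b i =
        a u * ∑ i ∈ Finset.Iio k, a (c i) * b i := by
      rw [Finset.mul_sum]
      exact Finset.sum_congr rfl fun i _ => by rw [map_mul, mul_assoc]
    have h3 : a u * a (c k) + a t * a φ = 1 := by
      rw [← map_mul, ← map_mul, ← map_add, hut, map_one]
    rw [hsplit, h1] at hzc
    rw [h2]
    linear_combination a u * hzc + b k * h3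
  have hle : ∀ i, i < k → e i ≤ e k := fun i hi =>
    (hmax k).le_of_integral hf (Fin.le_def.mp hi.le) (hpmonic i) (hpdeg i) (hbint i) (hbval i)
  have hlow : (∑ i ∈ Finset.Iio k, C (φ ^ (e k - e i) * (u * c i)) * p i).degree <
      (p k).degree := by
    rw [degree_eq_natDegree (hpmonic k).ne_zero, hpdeg]
    refine lt_of_le_of_lt (degree_sum_le _ _) ?_
    rw [Finset.sup_lt_iff (by exact WithBot.bot_lt_coe _)]
    intro i hi
    refine lt_of_le_of_lt ((degree_mul_le _ _).trans (add_le_of_nonpos_left degree_C_le)) ?_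
    rw [degree_eq_natDegree (hpmonic i).ne_zero, hpdeg]
    exact_mod_cast Finset.mem_Iio.mp hi
  refine (hmax k).2 ⟨p k + ∑ i ∈ Finset.Iio k, C (φ ^ (e k - e i) * (u * c i)) * p i,
    (hpmonic k).add_of_left hlow, ?_, z', hz', ?_⟩
  · rw [natDegree_add_eq_left_of_degree_lt hlow, hpdeg]
  · rw [toAf_add, toAf_sum, pow_succ, map_mul, mul_assoc]
    change a (φ ^ e k) * (a φ * z') = _
    rw [hφz', mul_add, Finset.mul_sum, ← hbval k]
    congr 1
    refine Finset.sum_congr rfl fun i hi => ?_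
    rw [toAf_mul, toAf_C, ← hbval i, ← Nat.sub_add_cancel (hle i (Finset.mem_Iio.mp hi)),
      Nat.add_sub_cancel, pow_add]
    change a _ * (a _ * _) = a _ * (a _ * _)
    simp only [map_mul]
    ring

end

/-- Let `b_d = p_d/φ^{e_d}` for `d = 0, …, n−1` be integral with `e_d` maximal for
degree `d` at `φ`. Then `b₀, …, b_{n−1}` form a local integral basis at `φ`: every
integral `z ∈ A_f` satisfies `s·z = c₀b₀ + ⋯ + c_{n−1}b_{n−1}` for some
`cᵢ ∈ K[x]` and `s ∈ K[x]` not divisible by `φ`. -/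
theorem local_integral_basis (K : Type*) [Field K] (n : ℕ)
    (hchar : ∀ p : ℕ, CharP K p → p = 0 ∨ n < p)
    (f : Polynomial (Polynomial K)) (hf : f.Monic) (hsf : Squarefree f)
    (hdeg : f.natDegree = n)
    (φ : Polynomial K) (hφ : Irreducible φ)
    (p : Fin n → Polynomial (Polynomial K)) (e : Fin n → ℕ)
    (b : Fin n → Af K f)
    (hpmonic : ∀ d, (p d).Monic) (hpdeg : ∀ d, (p d).natDegree = (d : ℕ))
    (hbint : ∀ d, IsIntegral (Polynomial K) (b d))
    (hbval : ∀ d, algebraMap (Polynomial K) (Af K f) (φ ^ e d) * b d = toAf f (p d))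
    (hmax : ∀ d : Fin n, MaximalExponent f φ (d : ℕ) (e d)) :
    ∀ z : Af K f, IsIntegral (Polynomial K) z →
      ∃ (c : Fin n → Polynomial K) (s : Polynomial K), ¬ φ ∣ s ∧
        algebraMap (Polynomial K) (Af K f) s * z =
          ∑ d, algebraMap (Polynomial K) (Af K f) (c d) * b d := by
  intro z hz
  obtain ⟨r, h, hr, hh, hrz⟩ := exists_mul_eq_toAf hf z
  rw [degree_eq_natDegree hf.ne_zero, hdeg] at hh
  obtain ⟨c, hc⟩ := exists_sum_C_mul_of_degree_lt p hpmonic hpdeg n le_rfl h hh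
  obtain ⟨m, s, hs, rfl⟩ := WfDvdMonoid.max_power_factor hr hφ
  have key : ∀ (m : ℕ) (c : Fin n → Polynomial K),
      algebraMap (Polynomial K) (Af K f) (φ ^ m * s) * z =
        ∑ d, algebraMap (Polynomial K) (Af K f) (c d) * b d →
      ∃ c : Fin n → Polynomial K, algebraMap (Polynomial K) (Af K f) s * z =
        ∑ d, algebraMap (Polynomial K) (Af K f) (c d) * b d := by
    intro m
    induction m with
    | zero => exact fun c hc => ⟨c, by simpa using hc⟩
    | succ m ih =>
      intro c hc
      rw [pow_succ', mul_assoc, map_mul, mul_assoc] at hc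
      choose q hq using dvd_coeff_of_integral hf hφ hpmonic hpdeg hbint hbval hmax
        (isIntegral_algebraMap.mul hz) hc
      refine ih q ((isUnit_algebraMap_Af (f := f) hφ.ne_zero).mul_left_cancel ?_)
      rw [hc, Finset.mul_sum]
      exact Finset.sum_congr rfl fun i _ => by rw [hq i, map_mul, mul_assoc]
  obtain ⟨c', hc'⟩ := key m (fun d => c d * φ ^ e d) (by
    rw [hrz, hc, toAf_sum]
    exact Finset.sum_congr rfl fun i _ => by
      rw [toAf_mul, toAf_C, ← hbval i, map_mul, mul_assoc])
  exact ⟨c', s, hs, hc'⟩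
end
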